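/- Let u > v be squarefree monomials of degree 2 in k[x₁,…,xₙ] and let Δ be the simplicial complex on [n] with Stanley-Reisner ideal I_Δ = (L(u,v)). If Δ is Buchsbaum but not Cohen-Macaulay over k, then Δ is disconnected. -/

import Mathlib

open Finset

/-- An abstract simplicial complex on the vertex type `V`: a collection of
finite subsets of `V` (the faces) closed under passing to subsets. -/
structure SComplex (V : Type*) where
  faces : Set (Finset V)
  down_closed : ∀ ⦃F G : Finset V⦄, F ∈ faces → G ⊆ F → G ∈ faces

namespace SComplex

variable {V : Type*} [DecidableEq V]

/-- The vertex set of a simplicial complex. -/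
def vertexSet (Δ : SComplex V) : Set V := {v | {v} ∈ Δ.faces}

/-- A facet is a maximal face. -/
def IsFacet (Δ : SComplex V) (F : Finset V) : Prop :=
  F ∈ Δ.faces ∧ ∀ G ∈ Δ.faces, F ⊆ G → F = G

/-- A complex is pure if all of its facets have the same dimension (cardinality). -/
def Pure (Δ : SComplex V) : Prop :=
  ∀ ⦃F G⦄, Δ.IsFacet F → Δ.IsFacet G → F.card = G.card

/-- One more than the dimension: the largest cardinality of a face of `Δ`.
So `Δ.dimSucc = d` means `Δ` has dimension `d - 1`. -/
noncomputable def dimSucc (Δ : SComplex V) : ℕ :=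
  sSup {n | ∃ F ∈ Δ.faces, F.card = n}

/-- The link of a face `F` : `link Δ F = {G ∈ Δ : G ∪ F ∈ Δ, G ∩ F = ∅}`. -/
def link (Δ : SComplex V) (F : Finset V) : SComplex V where
  faces := {G | G ∈ Δ.faces ∧ Disjoint G F ∧ G ∪ F ∈ Δ.faces}
  down_closed := by
    rintro G H ⟨hG, hdis, hGF⟩ hHG
    exact ⟨Δ.down_closed hG hHG, Finset.disjoint_of_subset_left hHG hdis,
      Δ.down_closed hGF (Finset.union_subset_union_left hHG)⟩

/-- A complex is connected if it has a vertex and any two vertices are joined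
by a path of edges (connectivity of the 1-skeleton). -/
def Connected (Δ : SComplex V) : Prop :=
  (∃ v, {v} ∈ Δ.faces) ∧
    ∀ a b : V, {a} ∈ Δ.faces → {b} ∈ Δ.faces →
      Relation.ReflTransGen (fun x y => x ≠ y ∧ ({x, y} : Finset V) ∈ Δ.faces) a b

/-- The join of two simplicial complexes (on disjoint vertex sets):
`Δ₁ ∗ Δ₂ = {F ∪ G : F ∈ Δ₁, G ∈ Δ₂}`. -/
def join (Δ₁ Δ₂ : SComplex V) : SComplex V where
  faces := {H | ∃ F ∈ Δ₁.faces, ∃ G ∈ Δ₂.faces, H = F ∪ G}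
  down_closed := by
    rintro H H' ⟨F, hF, G, hG, rfl⟩ hsub
    refine ⟨H' ∩ F, Δ₁.down_closed hF inter_subset_right,
      H' \ F, Δ₂.down_closed hG ?_, ?_⟩
    · intro x hx
      rcases Finset.mem_sdiff.mp hx with ⟨hx1, hx2⟩
      rcases Finset.mem_union.mp (hsub hx1) with h | h
      · exact absurd h hx2
      · exact h
    · ext x
      by_cases hx : x ∈ F <;>
        simp only [Finset.mem_union, Finset.mem_inter, Finset.mem_sdiff, hx] <;> tauto

/-- The full simplex on a finite vertex set `W`. -/
def simplexOn (W : Finset V) : SComplex V :=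
  ⟨{F | F ⊆ W}, fun _ _ hF hG => hG.trans hF⟩

/-- A shelling of `Δ`: an ordering `l` of all the facets of `Δ` such that each
facet meets the union of the previous ones in a nonempty union of
codimension-one faces of it. -/
def IsShelling (Δ : SComplex V) (l : List (Finset V)) : Prop :=
  l.Nodup ∧ (∀ F, F ∈ l ↔ Δ.IsFacet F) ∧
    ∀ i j : ℕ, j < i → i < l.length →
      ∃ m, m < i ∧ ∃ v ∈ l[i]!,
        l[i]! ∩ l[j]! ⊆ l[i]! ∩ l[m]! ∧ l[i]! ∩ l[m]! = l[i]!.erase v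

/-- A complex is shellable if its facets admit a shelling order. -/
def Shellable (Δ : SComplex V) : Prop := ∃ l, IsShelling Δ l

/-- The reduced homology `H̃₀(Δ; k)` vanishes: every `k`-linear combination of
vertices of `Δ` with coefficient sum zero is a `k`-linear combination of
boundaries of edges of `Δ`. -/
def ReducedH0Vanishes (k : Type*) [Field k] (Δ : SComplex V) : Prop :=
  ∀ f : V →₀ k, (∀ v ∈ f.support, {v} ∈ Δ.faces) → (f.sum fun _ c => c) = 0 →
    f ∈ Submodule.span k {g : V →₀ k | ∃ a b : V, a ≠ b ∧ ({a, b} : Finset V) ∈ Δ.faces ∧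
      g = Finsupp.single a 1 - Finsupp.single b 1}

end SComplex

/-- A commutative ring satisfies Serre's condition `S₂` if for every prime `p`
the localization at `p` contains, inside its maximal ideal, a regular sequence
of length at least `min 2 (dim R_p)`. -/
def RingSerreS2 (R : Type*) [CommRing R] : Prop :=
  ∀ (p : Ideal R) [p.IsPrime],
    ∃ rs : List (Localization.AtPrime p),
      (∀ r ∈ rs, r ∈ IsLocalRing.maximalIdeal (Localization.AtPrime p)) ∧
      RingTheory.Sequence.IsRegular (Localization.AtPrime p) rs ∧
      min 2 (ringKrullDim (Localization.AtPrime p)) ≤ (rs.length : WithBot ℕ∞)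

section GroundSet

/-- The squarefree monomial `∏_{i ∈ S} xᵢ` in the polynomial ring whose
variables are indexed by the ground set `W ⊆ ℕ`. -/
noncomputable def monoW (k : Type*) [CommRing k] (W S : Finset ℕ) :
    MvPolynomial {x // x ∈ W} k :=
  ∏ i ∈ S.subtype (· ∈ W), MvPolynomial.X i

/-- The Stanley–Reisner ideal of a complex `Δ` with ground (vertex) set `W ⊆ ℕ`,
inside the polynomial ring `k[xᵢ : i ∈ W]`: it is generated by the squarefree
monomials of the non-faces contained in `W`. -/
noncomputable def srIdealW (k : Type*) [CommRing k] (W : Finset ℕ) (Δ : SComplex ℕ) :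
    Ideal (MvPolynomial {x // x ∈ W} k) :=
  Ideal.span {p | ∃ F : Finset ℕ, F ⊆ W ∧ F ∉ Δ.faces ∧ p = monoW k W F}

/-- The Stanley–Reisner ring `k[Δ]` of a complex with ground set `W ⊆ ℕ`. -/
abbrev srRingW (k : Type*) [CommRing k] (W : Finset ℕ) (Δ : SComplex ℕ) :=
  MvPolynomial {x // x ∈ W} k ⧸ srIdealW k W Δ

/-- The irrelevant maximal ideal of the Stanley–Reisner ring. -/
noncomputable def srIrrelevantW (k : Type*) [CommRing k] (W : Finset ℕ)
    (Δ : SComplex ℕ) : Ideal (srRingW k W Δ) :=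
  (Ideal.span (Set.range (MvPolynomial.X : {x // x ∈ W} → MvPolynomial {x // x ∈ W} k))).map
    (Ideal.Quotient.mk (srIdealW k W Δ))

/-- `Δ` (a complex with ground set `W ⊆ ℕ`) is Cohen–Macaulay over the field `k`:
the ring `k[Δ]` admits a regular sequence, inside the irrelevant maximal ideal,
whose length equals the Krull dimension of `k[Δ]`. -/
def IsCMW (k : Type*) [Field k] (W : Finset ℕ) (Δ : SComplex ℕ) : Prop :=
  ∃ rs : List (srRingW k W Δ), (∀ r ∈ rs, r ∈ srIrrelevantW k W Δ) ∧
    RingTheory.Sequence.IsRegular (srRingW k W Δ) rs ∧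
    ringKrullDim (srRingW k W Δ) = (rs.length : WithBot ℕ∞)

/-- `Δ` is `CM_t` (Cohen–Macaulay in codimension `t`) over `k`: `Δ` is pure and
`link_Δ(F)` is Cohen–Macaulay over `k` for every face `F` with `#F ≥ t`.
`CM_1` is the Buchsbaum property. -/
def IsCMtW (k : Type*) [Field k] (W : Finset ℕ) (t : ℕ) (Δ : SComplex ℕ) : Prop :=
  Δ.Pure ∧ ∀ F ∈ Δ.faces, t ≤ F.card → IsCMW k W (Δ.link F)

end GroundSet

section Lex

/-- Comparison of squarefree monomials of the same degree in the lexicographic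
order with `x₁ > x₂ > ⋯ > xₙ`, the monomials being identified with their
supports: `u >_lex v` iff the smallest variable index where they differ
belongs to `u`. -/
def lexGT (A B : Finset ℕ) : Prop :=
  ∃ m ∈ A, m ∉ B ∧ ∀ x < m, (x ∈ A ↔ x ∈ B)

/-- `u ≥_lex v` for squarefree monomials identified with their supports. -/
def lexGE (A B : Finset ℕ) : Prop := A = B ∨ lexGT A B

/-- The lexsegment `L(u,v)` of squarefree monomials of degree `d` in
`x₁, …, xₙ`, the monomials being identified with their supports:
all `S ⊆ [n] = {1, …, n}` with `#S = d` and `u ≥_lex S ≥_lex v`. -/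
def lexSegment (n d : ℕ) (U V₀ : Finset ℕ) : Set (Finset ℕ) :=
  {S | S ⊆ Finset.Icc 1 n ∧ S.card = d ∧ lexGE U S ∧ lexGE S V₀}

/-- The ideal of `k[xᵢ : i ∈ W]` generated by the squarefree monomials of the
lexsegment `L(u,v)` (of degree-`d` squarefree monomials in `x₁, …, xₙ`). -/
noncomputable def lexIdealW (k : Type*) [CommRing k] (W : Finset ℕ) (n d : ℕ)
    (U V₀ : Finset ℕ) : Ideal (MvPolynomial {x // x ∈ W} k) :=
  Ideal.span {p | ∃ S ∈ lexSegment n d U V₀, p = monoW k W S}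

end Lex

section StanleyReisner

open MvPolynomial

lemma monoW_eq_monomial (k : Type*) [CommRing k] (W S : Finset ℕ) :
    monoW k W S = monomial (∑ i ∈ S.subtype (· ∈ W), Finsupp.single i 1) 1 := by
  rw [monoW, monomial_sum_one]
  rfl

lemma mem_srIdealW {k : Type*} [CommRing k] {W : Finset ℕ} {Δ : SComplex ℕ}
    {p : MvPolynomial {x // x ∈ W} k} :
    p ∈ srIdealW k W Δ ↔
      ∀ m ∈ p.support, m.support.map (Function.Embedding.subtype _) ∉ Δ.faces := by
  have key : srIdealW k W Δ = Ideal.span ((fun s => monomial s (1 : k)) ''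
      {s | ∃ F : Finset ℕ, F ⊆ W ∧ F ∉ Δ.faces ∧
        s = ∑ i ∈ F.subtype (· ∈ W), Finsupp.single i 1}) := by
    rw [srIdealW]
    congr 1
    ext q
    simp only [Set.mem_ofPred_eq, Set.mem_image, monoW_eq_monomial]
    constructor
    · rintro ⟨F, h1, h2, rfl⟩
      exact ⟨_, ⟨F, h1, h2, rfl⟩, rfl⟩
    · rintro ⟨_, ⟨F, h1, h2, rfl⟩, rfl⟩
      exact ⟨F, h1, h2, rfl⟩
  rw [key, mem_ideal_span_monomial_image]
  refine forall₂_congr fun m _ => ?_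
  constructor
  · rintro ⟨s, ⟨F, hFW, hF, rfl⟩, hs⟩ hm
    refine hF (Δ.down_closed hm fun i hi => ?_)
    have := hs ⟨i, hFW hi⟩
    rw [Finsupp.finsetSum_apply] at this
    simp only [Finsupp.single_apply, Finset.sum_ite_eq', Finset.mem_subtype, hi, if_true] at this
    simp only [Finset.mem_map, Finsupp.mem_support_iff]
    exact ⟨⟨i, hFW hi⟩, by omega, rfl⟩
  · intro hm
    refine ⟨_, ⟨_, ?_, hm, rfl⟩, fun i => ?_⟩
    · intro i hi
      obtain ⟨j, -, rfl⟩ := Finset.mem_map.1 hi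
      exact j.2
    · rw [Finsupp.finsetSum_apply]
      simp only [Finsupp.single_apply, Finset.sum_ite_eq', Finset.mem_subtype]
      split_ifs with h
      · obtain ⟨j, hj, hji⟩ := Finset.mem_map.1 h
        obtain rfl : j = i := Subtype.ext hji
        exact Nat.one_le_iff_ne_zero.2 (Finsupp.mem_support_iff.1 hj)
      · exact Nat.zero_le _

lemma map_monoW_eq_zero {k A : Type*} [CommRing k] [CommRing A] {W S : Finset ℕ} {i : ℕ}
    (hiW : i ∈ W) (hiS : i ∈ S) (φ : MvPolynomial {x // x ∈ W} k →+* A)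
    (hφ : φ (X ⟨i, hiW⟩) = 0) : φ (monoW k W S) = 0 := by
  rw [monoW, map_prod]
  exact Finset.prod_eq_zero (i := ⟨i, hiW⟩) (by simpa using hiS) hφ

lemma card_le_ringKrullDim_srRingW {k : Type*} [Field k] {W : Finset ℕ} {Δ : SComplex ℕ}
    {F : Finset ℕ} (hF : F ∈ Δ.faces) (hFW : F ⊆ W) :
    (F.card : WithBot ℕ∞) ≤ ringKrullDim (srRingW k W Δ) := by
  have hinj : Function.Injective (fun x : {x // x ∈ F} => (⟨x.1, hFW x.2⟩ : {x // x ∈ W})) :=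
    fun a b h => Subtype.ext (congrArg (fun x : {x // x ∈ W} => x.1) h)
  have hker : srIdealW k W Δ ≤ RingHom.ker (killCompl (R := k) hinj).toRingHom := by
    refine Ideal.span_le.2 ?_
    rintro _ ⟨G, hGW, hG, rfl⟩
    obtain ⟨i, hi, hiF⟩ := Finset.not_subset.1 fun h => hG (Δ.down_closed hF h)
    refine map_monoW_eq_zero (hGW hi) hi _ ?_
    simp only [killCompl, AlgHom.toRingHom_eq_coe, RingHom.coe_coe, aeval_X]
    rw [dif_neg]
    rintro ⟨y, hy⟩
    have hyi : y.1 = i := congrArg (fun x : {x // x ∈ W} => x.1) hy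
    exact hiF (hyi ▸ y.2)
  have hsurj : Function.Surjective (Ideal.Quotient.lift (srIdealW k W Δ)
      (killCompl (R := k) hinj).toRingHom fun a ha => hker ha) := fun q =>
    ⟨Ideal.Quotient.mk _ (rename _ q), killCompl_rename_app hinj q⟩
  have := ringKrullDim_le_of_surjective _ hsurj
  rw [MvPolynomial.ringKrullDim_of_isNoetherianRing, ringKrullDim_eq_zero_of_field] at this
  simpa using this

lemma ringKrullDim_le_of_surjective_of_srIdealW {k B : Type*} [Field k] [CommRing B] [IsDomain B]
    [Algebra k B] {W : Finset ℕ} {Δ : SComplex ℕ} {d : ℕ} (hd : ∀ F ∈ Δ.faces, F.card ≤ d)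
    (π : MvPolynomial {x // x ∈ W} k →ₐ[k] B) (hπ : Function.Surjective π)
    (hker : ∀ f ∈ srIdealW k W Δ, π f = 0) : ringKrullDim B ≤ d := by
  classical
  let s : Set {x // x ∈ W} := {i | π (X i) ≠ 0}
  let F : Finset {x // x ∈ W} := s.toFinset
  have hF : F.map (Function.Embedding.subtype _) ∈ Δ.faces := by
    by_contra h
    have h0 : monoW k W (F.map (Function.Embedding.subtype _)) ∈ srIdealW k W Δ := by
      refine Ideal.subset_span ⟨_, ?_, h, rfl⟩
      intro i hi
      obtain ⟨j, -, rfl⟩ := Finset.mem_map.1 hi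
      exact j.2
    have h1 := hker _ h0
    rw [monoW, map_prod] at h1
    obtain ⟨i, hi, hi0⟩ := Finset.prod_eq_zero_iff.1 h1
    obtain ⟨j, hj, hji⟩ := Finset.mem_map.1 (Finset.mem_subtype.1 hi)
    obtain rfl : j = i := Subtype.ext hji
    exact (Set.mem_toFinset.1 hj) hi0
  let ψ : MvPolynomial s k →ₐ[k] B := aeval fun i => π (X i.1)
  have hval : Function.Injective (fun x : s => x.1) := Subtype.val_injective
  have hcomp : π = ψ.comp (killCompl (R := k) hval) := by
    refine algHom_ext fun i => ?_
    by_cases hi : i ∈ s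
    · have : killCompl (R := k) hval (X i) = X ⟨i, hi⟩ := by
        rw [← killCompl_rename_app hval (X ⟨i, hi⟩), rename_X]
      rw [AlgHom.comp_apply, this]
      simp [ψ]
    · have : killCompl (R := k) hval (X i) = 0 := by
        rw [killCompl, aeval_X, dif_neg]
        rintro ⟨y, hy⟩
        exact hi (hy ▸ y.2)
      rw [AlgHom.comp_apply, this, map_zero]
      simpa [s] using hi
  have hψ : Function.Surjective ψ := by
    have : Function.Surjective (ψ ∘ killCompl (R := k) hval) := by
      rw [← AlgHom.coe_comp, ← hcomp]
      exact hπ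
    exact this.of_comp
  have := ringKrullDim_le_of_surjective (ψ : MvPolynomial s k →+* B) hψ
  rw [MvPolynomial.ringKrullDim_of_isNoetherianRing, ringKrullDim_eq_zero_of_field] at this
  refine this.trans ?_
  have hc := hd _ hF
  rw [Finset.card_map, Set.toFinset_card, ← Nat.card_eq_fintype_card] at hc
  rw [zero_add]
  exact_mod_cast hc

lemma ringKrullDim_srRingW_le {k : Type*} [Field k] {W : Finset ℕ} {Δ : SComplex ℕ} {d : ℕ}
    (hd : ∀ F ∈ Δ.faces, F.card ≤ d) : ringKrullDim (srRingW k W Δ) ≤ d := by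
  refine iSup_le fun l => ?_
  set q := l.head.asIdeal with hq
  have hle : (l.length : WithBot ℕ∞) ≤ ringKrullDim (srRingW k W Δ ⧸ q) := by
    rw [ringKrullDim_quotient]
    let l' : LTSeries (PrimeSpectrum.zeroLocus (R := srRingW k W Δ) q) :=
      { length := l.length
        toFun := fun i => ⟨l i, LTSeries.head_le l i⟩
        step := fun i => l.step i }
    exact le_iSup (fun p : LTSeries _ => (p.length : WithBot ℕ∞)) l'
  refine hle.trans ?_
  have : IsDomain (srRingW k W Δ ⧸ q) := Ideal.Quotient.isDomain q
  refine ringKrullDim_le_of_surjective_of_srIdealW (k := k) (B := srRingW k W Δ ⧸ q) (W := W) hd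
    ((Ideal.Quotient.mkₐ k q).comp (Ideal.Quotient.mkₐ k (srIdealW k W Δ)))
    (fun b => ?_) fun f hf => ?_
  · obtain ⟨a, rfl⟩ := Ideal.Quotient.mk_surjective b
    obtain ⟨f, rfl⟩ := Ideal.Quotient.mk_surjective a
    exact ⟨f, rfl⟩
  change Ideal.Quotient.mk q (Ideal.Quotient.mk _ _) = 0
  rw [Ideal.Quotient.eq_zero_iff_mem.2 hf, map_zero]

lemma srIrrelevantW_ne_top {k : Type*} [Field k] {W : Finset ℕ} {Δ : SComplex ℕ}
    (h : ∅ ∈ Δ.faces) : srIrrelevantW k W Δ ≠ ⊤ := by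
  have hker : srIdealW k W Δ ≤
      RingHom.ker (aeval (fun _ => 0) : MvPolynomial {x // x ∈ W} k →ₐ[k] k).toRingHom := by
    refine Ideal.span_le.2 ?_
    rintro _ ⟨G, hGW, hG, rfl⟩
    obtain ⟨i, hi⟩ := Finset.nonempty_iff_ne_empty.2 fun (h' : G = ∅) => hG (by rwa [h'])
    exact map_monoW_eq_zero (hGW hi) hi _ (by simp)
  have hle : srIrrelevantW k W Δ ≤ RingHom.ker (Ideal.Quotient.lift (srIdealW k W Δ)
      (aeval (fun _ => 0) : MvPolynomial {x // x ∈ W} k →ₐ[k] k).toRingHom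
        fun a ha => hker ha) := by
    rw [srIrrelevantW, Ideal.map_le_iff_le_comap, Ideal.span_le]
    rintro _ ⟨i, rfl⟩
    simp [RingHom.mem_ker]
  intro htop
  rw [htop, top_le_iff] at hle
  exact RingHom.ker_ne_top _ hle

lemma isRegular_of_isWeaklyRegular {k : Type*} [Field k] {W : Finset ℕ} {Δ : SComplex ℕ}
    (h : ∅ ∈ Δ.faces) {rs : List (srRingW k W Δ)} (hrs : ∀ r ∈ rs, r ∈ srIrrelevantW k W Δ)
    (hreg : RingTheory.Sequence.IsWeaklyRegular (srRingW k W Δ) rs) :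
    RingTheory.Sequence.IsRegular (srRingW k W Δ) rs := by
  refine ⟨hreg, fun htop => srIrrelevantW_ne_top (k := k) (W := W) h (top_le_iff.1 ?_)⟩
  rw [htop, smul_eq_mul, Ideal.mul_top]
  exact Ideal.span_le.2 hrs

lemma ringKrullDim_srRingW_eq_sup_card (k : Type*) [Field k] {W : Finset ℕ} {Δ : SComplex ℕ}
    {F : Finset ℕ} (hF : F ∈ Δ.faces) (hFW : F ⊆ W) (hmax : ∀ G ∈ Δ.faces, G.card ≤ F.card) :
    ringKrullDim (srRingW k W Δ) = F.card :=
  le_antisymm (ringKrullDim_srRingW_le hmax) (card_le_ringKrullDim_srRingW hF hFW)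

lemma SComplex.exists_face_card_max {Δ : SComplex ℕ} {W : Finset ℕ} (hW : ∀ F ∈ Δ.faces, F ⊆ W)
    (h : ∅ ∈ Δ.faces) : ∃ F ∈ Δ.faces, ∀ G ∈ Δ.faces, G.card ≤ F.card := by
  have hfin : Δ.faces.Finite :=
    (Finset.finite_toSet W.powerset).subset fun F hF => by simpa using hW F hF
  exact hfin.exists_maximalFor Finset.card _ ⟨_, h⟩ |>.imp fun F hF =>
    ⟨hF.1, fun G hG => (le_total _ _).elim id fun hle => hF.2 hG hle⟩

lemma support_add_single_one {σ : Type*} [DecidableEq σ] (m : σ →₀ ℕ) (i : σ) :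
    (m + Finsupp.single i 1).support = insert i m.support := by
  ext j
  by_cases hj : j = i <;> simp [hj, Ne.symm]

open scoped Pointwise in
lemma isWeaklyRegular_cons_of_surjective {A B : Type*} [CommRing A] [CommRing B] [Algebra A B]
    (hsurj : Function.Surjective (algebraMap A B)) {x : A} {rs : List A} (hx : IsSMulRegular A x)
    (hker : ∀ a, algebraMap A B a = 0 ↔ ∃ b, x * b = a)
    (hrs : RingTheory.Sequence.IsWeaklyRegular B (rs.map (algebraMap A B))) :
    RingTheory.Sequence.IsWeaklyRegular A (x :: rs) := by
  have hker' : x • (⊤ : Submodule A A) = LinearMap.ker (Algebra.linearMap A B) := by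
    ext a
    rw [Submodule.mem_smul_pointwise_iff_exists]
    refine Iff.trans ?_ (hker a).symm
    simp
  have hsurj' : Function.Surjective (Algebra.linearMap A B) := hsurj
  have e₁ : (A ⧸ LinearMap.ker (Algebra.linearMap A B)) ≃ₗ[A] B :=
    (Algebra.linearMap A B).quotKerEquivOfSurjective hsurj'
  have e₂ : QuotSMulTop x A ≃ₗ[A] A ⧸ LinearMap.ker (Algebra.linearMap A B) :=
    Submodule.quotEquivOfEq _ _ hker'
  have hB : RingTheory.Sequence.IsWeaklyRegular B rs :=
    (RingTheory.Sequence.isWeaklyRegular_map_algebraMap_iff (R := A) B B rs).1 hrs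
  exact (RingTheory.Sequence.isWeaklyRegular_cons_iff A x rs).2
    ⟨hx, (LinearEquiv.isWeaklyRegular_congr (e₂.trans e₁) rs).2 hB⟩

section Cone

variable {k : Type*} [Field k] {W : Finset ℕ} {Δ : SComplex ℕ} {p : ℕ}

lemma mem_srIdealW_of_X_mul_mem (hcone : ∀ F ∈ Δ.faces, insert p F ∈ Δ.faces) (hpW : p ∈ W)
    {f : MvPolynomial {x // x ∈ W} k} (hf : X ⟨p, hpW⟩ * f ∈ srIdealW k W Δ) :
    f ∈ srIdealW k W Δ := by
  rw [mem_srIdealW] at hf ⊢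
  intro m hm hmΔ
  refine hf (m + Finsupp.single ⟨p, hpW⟩ 1) ?_ ?_
  · rw [mem_support_iff, add_comm, coeff_X_mul]
    exact mem_support_iff.1 hm
  · rw [support_add_single_one, Finset.map_insert]
    exact hcone _ hmΔ

lemma SComplex.mem_link_singleton_of_cone (hcone : ∀ F ∈ Δ.faces, insert p F ∈ Δ.faces)
    {F : Finset ℕ} : F ∈ (Δ.link {p}).faces ↔ F ∈ Δ.faces ∧ p ∉ F := by
  refine ⟨fun h => ⟨h.1, Finset.disjoint_singleton_right.1 h.2.1⟩, fun h =>
    ⟨h.1, Finset.disjoint_singleton_right.2 h.2, ?_⟩⟩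
  rw [Finset.union_comm, ← Finset.insert_eq]
  exact hcone _ h.1

lemma mem_srIdealW_link_iff_of_cone (hcone : ∀ F ∈ Δ.faces, insert p F ∈ Δ.faces) (hpW : p ∈ W)
    {f : MvPolynomial {x // x ∈ W} k} : f ∈ srIdealW k W (Δ.link {p}) ↔
      ∃ g, f - X ⟨p, hpW⟩ * g ∈ srIdealW k W Δ := by
  have hle : srIdealW k W Δ ≤ srIdealW k W (Δ.link {p}) := fun g hg => by
    rw [mem_srIdealW] at hg ⊢
    exact fun m hm hmΔ => hg m hm hmΔ.1
  constructor
  · intro hf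
    refine ⟨divMonomial f (Finsupp.single ⟨p, hpW⟩ 1), ?_⟩
    have hdiv := divMonomial_add_modMonomial_single f ⟨p, hpW⟩
    rw [← eq_sub_iff_add_eq'] at hdiv
    rw [← hdiv, mem_srIdealW]
    rw [mem_srIdealW] at hf
    intro m hm hmΔ
    rw [mem_support_iff] at hm
    by_cases hle : Finsupp.single ⟨p, hpW⟩ 1 ≤ m
    · exact hm (coeff_modMonomial_of_le _ hle)
    · rw [coeff_modMonomial_of_not_le _ hle] at hm
      refine hf m (mem_support_iff.2 hm)
        ((SComplex.mem_link_singleton_of_cone hcone).2 ⟨hmΔ, fun hpm => hle ?_⟩)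
      obtain ⟨j, hj, hjp⟩ := Finset.mem_map.1 hpm
      obtain rfl : j = ⟨p, hpW⟩ := Subtype.ext hjp
      rw [Finsupp.single_le_iff]
      exact Nat.one_le_iff_ne_zero.2 (Finsupp.mem_support_iff.1 hj)
  · rintro ⟨g, hg⟩
    have hX : (X ⟨p, hpW⟩ : MvPolynomial {x // x ∈ W} k) ∈ srIdealW k W (Δ.link {p}) := by
      rw [mem_srIdealW]
      intro m hm hmΔ
      rw [support_X, Finset.mem_singleton] at hm
      refine ((SComplex.mem_link_singleton_of_cone hcone).1 hmΔ).2 ?_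
      simp [hm]
    have := add_mem (hle hg) (Ideal.mul_mem_right g _ hX)
    rwa [sub_add_cancel] at this

theorem isCMW_of_cone (hW : ∀ F ∈ Δ.faces, F ⊆ W) (hp : {p} ∈ Δ.faces)
    (hcone : ∀ F ∈ Δ.faces, insert p F ∈ Δ.faces) (hlink : IsCMW k W (Δ.link {p})) :
    IsCMW k W Δ := by
  obtain ⟨rs, hrs, hreg, hdim⟩ := hlink
  have hpW : p ∈ W := hW _ hp (Finset.mem_singleton_self p)
  have h0 : ∅ ∈ Δ.faces := Δ.down_closed hp (Finset.empty_subset _)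
  have hle : srIdealW k W Δ ≤ srIdealW k W (Δ.link {p}) := fun g hg =>
    (mem_srIdealW_link_iff_of_cone hcone hpW).2 ⟨0, by simpa using hg⟩
  let φ := Ideal.Quotient.factor hle
  have hφ : Function.Surjective φ := Ideal.Quotient.factor_surjective hle
  have hirr : (srIrrelevantW k W Δ).map φ = srIrrelevantW k W (Δ.link {p}) := by
    rw [srIrrelevantW, srIrrelevantW, Ideal.map_map, Ideal.Quotient.factor_comp_mk]
  have hlift : ∀ r ∈ rs, ∃ r' ∈ srIrrelevantW k W Δ, φ r' = r := fun r hr => by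
    have := hrs r hr
    rw [← hirr, Ideal.mem_map_iff_of_surjective φ hφ] at this
    exact this
  obtain ⟨rs', hrs', rfl⟩ : ∃ rs' : List (srRingW k W Δ),
      (∀ r ∈ rs', r ∈ srIrrelevantW k W Δ) ∧ rs'.map φ = rs := by
    clear hreg hdim hrs
    induction rs with
    | nil => exact ⟨[], by simp, rfl⟩
    | cons r rs ih =>
      obtain ⟨rs', h1, h2⟩ := ih fun r hr => hlift r (List.mem_cons_of_mem _ hr)
      obtain ⟨r', h3, h4⟩ := hlift r List.mem_cons_self
      exact ⟨r' :: rs', by simpa using ⟨h3, h1⟩, by simp [h2, h4]⟩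
  let x : srRingW k W Δ := Ideal.Quotient.mk _ (X ⟨p, hpW⟩)
  have hx : x ∈ srIrrelevantW k W Δ :=
    Ideal.mem_map_of_mem _ (Ideal.subset_span ⟨_, rfl⟩)
  have hxreg : IsSMulRegular (srRingW k W Δ) x := by
    rw [isSMulRegular_iff_right_eq_zero_of_smul]
    intro a ha
    obtain ⟨f, rfl⟩ := Ideal.Quotient.mk_surjective a
    rw [smul_eq_mul, ← map_mul, Ideal.Quotient.eq_zero_iff_mem] at ha
    exact Ideal.Quotient.eq_zero_iff_mem.2 (mem_srIdealW_of_X_mul_mem hcone hpW ha)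
  have hker : ∀ a, φ a = 0 ↔ ∃ b, x * b = a := by
    intro a
    obtain ⟨f, rfl⟩ := Ideal.Quotient.mk_surjective a
    rw [Ideal.Quotient.factor_mk, Ideal.Quotient.eq_zero_iff_mem,
      mem_srIdealW_link_iff_of_cone hcone hpW]
    constructor
    · rintro ⟨g, hg⟩
      refine ⟨Ideal.Quotient.mk _ g, ?_⟩
      rw [← map_mul, eq_comm, Ideal.Quotient.eq]
      exact hg
    · rintro ⟨b, hb⟩
      obtain ⟨g, rfl⟩ := Ideal.Quotient.mk_surjective b
      rw [← map_mul, eq_comm, Ideal.Quotient.eq] at hb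
      exact ⟨g, hb⟩
  let : Algebra (srRingW k W Δ) (srRingW k W (Δ.link {p})) := φ.toAlgebra
  have hweak := isWeaklyRegular_cons_of_surjective hφ hxreg hker hreg.toIsWeaklyRegular
  have hmem : ∀ r ∈ x :: rs', r ∈ srIrrelevantW k W Δ := by
    simpa using ⟨hx, hrs'⟩
  refine ⟨x :: rs', hmem, isRegular_of_isWeaklyRegular h0 hmem hweak, ?_⟩
  have hW' : ∀ F ∈ (Δ.link {p}).faces, F ⊆ W := fun F hF => hW F hF.1
  obtain ⟨F, hF, hmax⟩ := SComplex.exists_face_card_max hW'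
    ((SComplex.mem_link_singleton_of_cone hcone).2 ⟨h0, by simp⟩)
  rw [ringKrullDim_srRingW_eq_sup_card k hF (hW' F hF) hmax] at hdim
  rw [SComplex.mem_link_singleton_of_cone hcone] at hF
  have hcard : F.card + 1 = (insert p F).card := (Finset.card_insert_of_notMem hF.2).symm
  rw [ringKrullDim_srRingW_eq_sup_card k (hcone F hF.1) (hW _ (hcone F hF.1)), ← hcard]
  · rw [List.length_map] at hdim
    rw [List.length_cons, Nat.cast_add, Nat.cast_add, hdim]
  · intro G hG
    have := hmax (G.erase p) ((SComplex.mem_link_singleton_of_cone hcone).2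
      ⟨Δ.down_closed hG (Finset.erase_subset _ _), Finset.notMem_erase _ _⟩)
    have := Finset.pred_card_le_card_erase (s := G) (a := p)
    omega

end Cone

open scoped Pointwise in
lemma isWeaklyRegular_pair {A : Type*} [CommRing A] {x y : A} (hx : ∀ a, x * a = 0 → a = 0)
    (hy : ∀ a b, y * a = x * b → ∃ c, a = x * c) :
    RingTheory.Sequence.IsWeaklyRegular A [x, y] := by
  rw [RingTheory.Sequence.isWeaklyRegular_cons_iff,
    RingTheory.Sequence.isWeaklyRegular_singleton_iff]
  refine ⟨isSMulRegular_iff_right_eq_zero_of_smul.2 hx,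
    (isSMulRegular_quotient_iff_mem_of_smul_mem _ _).2 fun a ha => ?_⟩
  rw [Submodule.mem_smul_pointwise_iff_exists] at ha ⊢
  obtain ⟨b, -, hb⟩ := ha
  obtain ⟨c, hc⟩ := hy a b hb.symm
  exact ⟨c, trivial, hc.symm⟩

section Restriction

variable {σ k : Type*} [DecidableEq σ] [Field k]

/-- The endomorphism of the polynomial ring fixing the variables in `e` and killing the others. -/
noncomputable def restrictVars (k : Type*) [Field k] (e : Finset σ) :
    MvPolynomial σ k →ₐ[k] MvPolynomial σ k :=
  aeval fun i => if i ∈ e then X i else 0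

lemma restrictVars_X (e : Finset σ) (i : σ) :
    restrictVars k e (X i) = if i ∈ e then X i else 0 :=
  aeval_X _ _

lemma coeff_restrictVars (e : Finset σ) (f : MvPolynomial σ k) (m : σ →₀ ℕ) :
    coeff m (restrictVars k e f) = if m.support ⊆ e then coeff m f else 0 := by
  induction f using MvPolynomial.induction_on' with
  | add p q hp hq =>
    rw [map_add, coeff_add, hp, hq, coeff_add]
    split_ifs <;> simp
  | monomial u a =>
    have hmon : restrictVars k e (monomial u a) = if u.support ⊆ e then monomial u a else 0 := by
      rw [restrictVars, aeval_monomial]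
      split_ifs with h
      · rw [monomial_eq]
        refine congrArg _ (Finset.prod_congr rfl fun i hi => ?_)
        simp only [if_pos (h hi)]
      · obtain ⟨i, hi, hie⟩ := Finset.not_subset.1 h
        rw [Finsupp.prod, Finset.prod_eq_zero hi, mul_zero]
        simp only [if_neg hie]
        exact zero_pow (Finsupp.mem_support_iff.1 hi)
    rw [hmon]
    by_cases hum : u = m
    · subst hum
      split_ifs <;> simp
    · split_ifs <;> simp [coeff_monomial, hum]

lemma restrictVars_eq_zero_iff {e : Finset σ} {f : MvPolynomial σ k} :
    restrictVars k e f = 0 ↔ ∀ m ∈ f.support, ¬ m.support ⊆ e := by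
  refine ⟨fun h m hm hme => ?_, fun h => MvPolynomial.ext _ _ fun m => ?_⟩
  · have := congrArg (coeff m) h
    rw [coeff_restrictVars, if_pos hme, coeff_zero] at this
    exact mem_support_iff.1 hm this
  · rw [coeff_restrictVars, coeff_zero]
    split_ifs with hme
    · by_contra hm
      exact h m (mem_support_iff.2 hm) hme
    · rfl

lemma restrictVars_sum_X [Fintype σ] (e : Finset σ) :
    restrictVars k e (∑ i, X i) = ∑ i ∈ e, X i := by
  simp [map_sum, restrictVars_X]

lemma restrictVars_sum_powersetCard [Fintype σ] (e : Finset σ) :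
    restrictVars k e (∑ t ∈ Finset.univ.powersetCard e.card, ∏ i ∈ t, X i) = ∏ i ∈ e, X i := by
  rw [map_sum, Finset.sum_eq_single e]
  · rw [map_prod]
    exact Finset.prod_congr rfl fun i hi => by rw [restrictVars_X, if_pos hi]
  · intro t ht hte
    rw [Finset.mem_powersetCard] at ht
    obtain ⟨i, hi, hie⟩ := Finset.not_subset.1 fun h => hte (Finset.eq_of_subset_of_card_le h ht.2.ge)
    rw [map_prod, Finset.prod_eq_zero hi]
    rw [restrictVars_X, if_neg hie]
  · intro h
    exact absurd (Finset.mem_powersetCard.2 ⟨Finset.subset_univ _, rfl⟩) h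

lemma exists_coeff_eq_of_compatible [Fintype σ] {E : Set (Finset σ)}
    {H : Finset σ → MvPolynomial σ k}
    (hH : ∀ e ∈ E, ∀ e' ∈ E, ∀ m : σ →₀ ℕ, m.support ⊆ e → m.support ⊆ e' →
      coeff m (H e) = coeff m (H e')) :
    ∃ h : MvPolynomial σ k, ∀ e ∈ E, ∀ m : σ →₀ ℕ, m.support ⊆ e →
      coeff m h = coeff m (H e) := by
  classical
  let c : (σ →₀ ℕ) → k := fun m =>
    if hm : ∃ e ∈ E, m.support ⊆ e then coeff m (H hm.choose) else 0
  have hc : ∀ e ∈ E, ∀ m : σ →₀ ℕ, m.support ⊆ e → c m = coeff m (H e) := by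
    intro e he m hm
    have hex : ∃ e ∈ E, m.support ⊆ e := ⟨e, he, hm⟩
    simp only [c, dif_pos hex]
    exact hH _ hex.choose_spec.1 _ he m hex.choose_spec.2 hm
  refine ⟨∑ m ∈ Finset.univ.biUnion fun e => (H e).support, monomial m (c m), ?_⟩
  intro e he m hm
  rw [← hc e he m hm, coeff_sum]
  simp only [coeff_monomial, Finset.sum_ite_eq']
  split_ifs with h
  · rfl
  · rw [hc e he m hm]
    by_contra hne
    exact h (Finset.mem_biUnion.2 ⟨e, Finset.mem_univ _, mem_support_iff.2 (Ne.symm hne)⟩)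

omit [DecidableEq σ] in
lemma X_add_X_dvd_of_X_mul_X_mul_eq {i j : σ} (hij : i ≠ j) {P Q : MvPolynomial σ k}
    (h : X i * X j * P = (X i + X j) * Q) : X i + X j ∣ P := by
  have hnot : ∀ {a b : σ}, a ≠ b → ¬ (X a : MvPolynomial σ k) ∣ X a + X b := fun hab hdvd => by
    rw [dvd_add_right (dvd_refl _), X_dvd_X] at hdvd
    exact hab hdvd
  have hi : (X i : MvPolynomial σ k) ∣ Q :=
    (X_dvd_mul_iff.1 ⟨X j * P, by linear_combination -h⟩).resolve_left (hnot hij)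
  obtain ⟨Q, rfl⟩ := hi
  have h' : X j * P = (X i + X j) * Q := mul_left_cancel₀ (X_ne_zero i) (by linear_combination h)
  have hdvd : (X j : MvPolynomial σ k) ∣ (X j + X i) * Q := ⟨P, by linear_combination -h'⟩
  have hj : (X j : MvPolynomial σ k) ∣ Q := (X_dvd_mul_iff.1 hdvd).resolve_left (hnot hij.symm)
  obtain ⟨Q, rfl⟩ := hj
  exact ⟨Q, mul_left_cancel₀ (X_ne_zero j) (by linear_combination h')⟩

lemma coeff_single_succ_X_add_X_mul {i j : σ} (hij : i ≠ j) (D : MvPolynomial σ k) (t : ℕ) :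
    coeff (Finsupp.single i (t + 1)) ((X i + X j) * D) = coeff (Finsupp.single i t) D := by
  rw [add_mul, coeff_add, add_comm t 1, Finsupp.single_add, coeff_X_mul, ← Finsupp.single_add,
    coeff_X_mul', if_neg, add_zero]
  simp [hij]

end Restriction

section Graph

variable {σ k : Type*} [DecidableEq σ] [Fintype σ] [Field k] {E : Set (Finset σ)}

lemma restrictVars_eq_zero_of_sum_X_mul {e : Finset σ} (he : e.card = 2) {f : MvPolynomial σ k}
    (h : restrictVars k e ((∑ i, X i) * f) = 0) : restrictVars k e f = 0 := by
  obtain ⟨i, j, hij, rfl⟩ := Finset.card_eq_two.1 he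
  rw [map_mul, restrictVars_sum_X, Finset.sum_pair hij] at h
  refine (mul_eq_zero.1 h).resolve_left fun h0 => ?_
  have := congrArg (coeff (Finsupp.single i 1)) h0
  simp [coeff_X, Finsupp.single_left_inj, hij.symm] at this

lemma exists_sum_X_mul_of_restrictVars (hE : ∀ e ∈ E, e.card = 2)
    (hconn : ∀ c : σ → k, (∀ e ∈ E, ∀ i ∈ e, ∀ j ∈ e, c i = c j) →
      ∀ e ∈ E, ∀ e' ∈ E, ∀ i ∈ e, ∀ j ∈ e', c i = c j)
    {f g : MvPolynomial σ k}
    (h : ∀ e ∈ E, restrictVars k e ((∑ t ∈ Finset.univ.powersetCard 2, ∏ i ∈ t, X i) * f -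
      (∑ i, X i) * g) = 0) :
    ∃ q : MvPolynomial σ k, ∀ e ∈ E, restrictVars k e (f - (∑ i, X i) * q) = 0 := by
  have hdvd : ∀ e ∈ E, ∃ D, restrictVars k e f = (∑ i ∈ e, X i) * D := by
    intro e he
    have h1 := h e he
    rw [map_sub, map_mul, map_mul, restrictVars_sum_X, sub_eq_zero, ← hE e he,
      restrictVars_sum_powersetCard] at h1
    obtain ⟨i, j, hij, rfl⟩ := Finset.card_eq_two.1 (hE e he)
    rw [Finset.prod_pair hij, Finset.sum_pair hij] at h1
    rw [Finset.sum_pair hij]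
    exact X_add_X_dvd_of_X_mul_X_mul_eq hij h1
  choose! D hD using hdvd
  have hcoeff : ∀ e ∈ E, ∀ i ∈ e, ∀ t,
      coeff (Finsupp.single i t) (D e) = coeff (Finsupp.single i (t + 1)) f := by
    intro e he i hi t
    have h1 := congrArg (coeff (Finsupp.single i (t + 1))) (hD e he)
    rw [coeff_restrictVars, if_pos
      (Finsupp.support_single_subset.trans (Finset.singleton_subset_iff.2 hi))] at h1
    obtain ⟨j, hj⟩ : ∃ j, e.erase i = {j} := by
      rw [← Finset.card_eq_one, Finset.card_erase_of_mem hi, hE e he]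
    have hij : i ≠ j := by
      rintro rfl
      exact Finset.notMem_erase i e (hj ▸ Finset.mem_singleton_self i)
    rw [h1, ← Finset.add_sum_erase _ _ hi, hj, Finset.sum_singleton,
      coeff_single_succ_X_add_X_mul hij]
  have hconst := hconn (fun i => coeff (Finsupp.single i 1) f) fun e he i hi j hj => by
    have h1 := hcoeff e he i hi 0
    have h2 := hcoeff e he j hj 0
    rw [Finsupp.single_zero] at h1 h2
    exact h1.symm.trans h2
  obtain ⟨q, hq⟩ := exists_coeff_eq_of_compatible (E := E) (H := D) <| by
    intro e he e' he' m hm hm'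
    rcases m.support.eq_empty_or_nonempty with h0 | ⟨i, hi⟩
    · obtain rfl := Finsupp.support_eq_empty.1 h0
      obtain ⟨i, hi⟩ := Finset.card_pos.1 ((hE e he).symm ▸ two_pos)
      obtain ⟨j, hj⟩ := Finset.card_pos.1 ((hE e' he').symm ▸ two_pos)
      have h1 := hcoeff e he i hi 0
      have h2 := hcoeff e' he' j hj 0
      rw [Finsupp.single_zero] at h1 h2
      rw [h1, h2]
      exact hconst e he e' he' i hi j hj
    · by_cases hs : m.support = {i}
      · obtain ⟨t, ht⟩ : ∃ t, m = Finsupp.single i t :=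
          ⟨m i, (Finsupp.support_subset_singleton.1 hs.le)⟩
        rw [ht, hcoeff e he i (hm hi), hcoeff e' he' i (hm' hi)]
      · have hcard : 2 ≤ m.support.card := by
          by_contra hlt
          exact hs (Finset.eq_of_subset_of_card_le (Finset.singleton_subset_iff.2 hi)
            (by rw [Finset.card_singleton]; omega)).symm
        rw [← Finset.eq_of_subset_of_card_le hm ((hE e he).trans_le hcard),
          ← Finset.eq_of_subset_of_card_le hm' ((hE e' he').trans_le hcard)]
  refine ⟨q, fun e he => ?_⟩
  have hfix : ∀ p, restrictVars k e (restrictVars k e p) = restrictVars k e p := fun p =>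
    MvPolynomial.ext _ _ fun m => by
      rw [coeff_restrictVars, coeff_restrictVars]
      split_ifs <;> rfl
  have hqD : restrictVars k e q = restrictVars k e (D e) :=
    MvPolynomial.ext _ _ fun m => by
      rw [coeff_restrictVars, coeff_restrictVars]
      split_ifs with hm
      · exact hq e he m hm
      · rfl
  have hsum : restrictVars k e (∑ i ∈ e, X i) = ∑ i ∈ e, X i := by
    rw [← restrictVars_sum_X, hfix]
  rw [map_sub, map_mul, hqD, restrictVars_sum_X, ← hfix f, hD e he, map_mul, hsum, sub_self]

end Graph

section ConnectedGraph

variable {k : Type*} [Field k] {W : Finset ℕ} {Δ : SComplex ℕ}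

lemma SComplex.Connected.exists_edge (hconn : Δ.Connected) {a b : ℕ} (ha : {a} ∈ Δ.faces)
    (hb : {b} ∈ Δ.faces) (hab : a ≠ b) : ∃ c, a ≠ c ∧ ({a, c} : Finset ℕ) ∈ Δ.faces := by
  rcases (hconn.2 a b ha hb).cases_head with h | ⟨c, hc, -⟩
  · exact absurd h hab
  · exact ⟨c, hc⟩

lemma SComplex.Connected.eq_of_forall_edge (hconn : Δ.Connected) {α : Type*} {c : ℕ → α}
    (hc : ∀ a b, a ≠ b → ({a, b} : Finset ℕ) ∈ Δ.faces → c a = c b) {a b : ℕ}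
    (ha : {a} ∈ Δ.faces) (hb : {b} ∈ Δ.faces) : c a = c b := by
  have := hconn.2 a b ha hb
  clear hb
  induction this with
  | refl => rfl
  | tail _ h ih => exact ih.trans (hc _ _ h.1 h.2)

/-- The edges of `Δ`, as sets of variables of the polynomial ring on the ground set `W`. -/
def SComplex.edges (Δ : SComplex ℕ) (W : Finset ℕ) : Set (Finset {x // x ∈ W}) :=
  {e | e.card = 2 ∧ e.map (Function.Embedding.subtype _) ∈ Δ.faces}

lemma SComplex.exists_edge_superset (hW : ∀ F ∈ Δ.faces, F ⊆ W)
    (hdim : ∀ F ∈ Δ.faces, F.card ≤ 2) (hconn : Δ.Connected) {F : Finset ℕ} (hF : F ∈ Δ.faces)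
    (hFcard : F.card = 2) {S : Finset {x // x ∈ W}}
    (hS : S.map (Function.Embedding.subtype _) ∈ Δ.faces) : ∃ e ∈ Δ.edges W, S ⊆ e := by
  have lift : ∀ G ∈ Δ.faces, G.card = 2 → S.map (Function.Embedding.subtype _) ⊆ G →
      ∃ e ∈ Δ.edges W, S ⊆ e := by
    intro G hG hGcard hSG
    have hGW : (G.subtype (· ∈ W)).map (Function.Embedding.subtype _) = G :=
      Finset.subtype_map_of_mem (hW G hG)
    refine ⟨G.subtype (· ∈ W), ⟨?_, hGW.symm ▸ hG⟩, fun i hi => Finset.mem_subtype.2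
      (hSG (Finset.mem_map_of_mem _ hi))⟩
    rw [← hGcard, ← Finset.card_map (Function.Embedding.subtype _), hGW]
  have hScard := hdim _ hS
  interval_cases hc : (S.map (Function.Embedding.subtype (· ∈ W))).card
  · rw [Finset.card_eq_zero] at hc
    exact lift F hF hFcard (hc ▸ Finset.empty_subset _)
  · obtain ⟨a, ha⟩ := Finset.card_eq_one.1 hc
    rw [ha] at hS lift
    obtain ⟨x, y, hxy, rfl⟩ := Finset.card_eq_two.1 hFcard
    obtain ⟨b, hbΔ, hab⟩ : ∃ b, {b} ∈ Δ.faces ∧ a ≠ b := by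
      by_cases hax : a = x
      · exact ⟨y, Δ.down_closed hF (by simp), hax ▸ hxy⟩
      · exact ⟨x, Δ.down_closed hF (by simp), hax⟩
    obtain ⟨c, hac, hacΔ⟩ := hconn.exists_edge hS hbΔ hab
    exact lift _ hacΔ (Finset.card_pair hac) (by simp)
  · exact lift _ hS hc subset_rfl

theorem isCMW_of_connected_graph (hW : ∀ F ∈ Δ.faces, F ⊆ W)
    (hdim : ∀ F ∈ Δ.faces, F.card ≤ 2) (hconn : Δ.Connected) {F : Finset ℕ} (hF : F ∈ Δ.faces)
    (hFcard : F.card = 2) : IsCMW k W Δ := by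
  have hE : ∀ e ∈ Δ.edges W, e.card = 2 := fun e he => he.1
  have hmem : ∀ f : MvPolynomial {x // x ∈ W} k,
      f ∈ srIdealW k W Δ ↔ ∀ e ∈ Δ.edges W, restrictVars k e f = 0 := by
    intro f
    simp only [mem_srIdealW, restrictVars_eq_zero_iff]
    constructor
    · exact fun h e he m hm hme => h m hm (Δ.down_closed he.2 (Finset.map_subset_map.2 hme))
    · intro h m hm hmΔ
      obtain ⟨e, he, hme⟩ := SComplex.exists_edge_superset hW hdim hconn hF hFcard hmΔ
      exact h e he m hm hme
  have hC : ∀ c : {x // x ∈ W} → k, (∀ e ∈ Δ.edges W, ∀ i ∈ e, ∀ j ∈ e, c i = c j) →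
      ∀ e ∈ Δ.edges W, ∀ e' ∈ Δ.edges W, ∀ i ∈ e, ∀ j ∈ e', c i = c j := by
    intro c hc e he e' he' i hi j hj
    have key := hconn.eq_of_forall_edge (c := fun a => if h : a ∈ W then c ⟨a, h⟩ else 0)
      (a := i.1) (b := j.1) ?_ (Δ.down_closed he.2 ?_) (Δ.down_closed he'.2 ?_)
    · simpa using key
    · intro a b hab hΔ
      have haW : a ∈ W := hW _ hΔ (by simp)
      have hbW : b ∈ W := hW _ hΔ (by simp)
      simp only [dif_pos haW, dif_pos hbW]
      refine hc {⟨a, haW⟩, ⟨b, hbW⟩} ⟨Finset.card_pair (by simpa using hab), ?_⟩ _ (by simp) _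
        (by simp)
      simpa using hΔ
    · exact Finset.singleton_subset_iff.2 (Finset.mem_map_of_mem _ hi)
    · exact Finset.singleton_subset_iff.2 (Finset.mem_map_of_mem _ hj)
  let θ₁ : MvPolynomial {x // x ∈ W} k := ∑ i, X i
  let θ₂ : MvPolynomial {x // x ∈ W} k := ∑ t ∈ Finset.univ.powersetCard 2, ∏ i ∈ t, X i
  have hweak : RingTheory.Sequence.IsWeaklyRegular (srRingW k W Δ)
      [Ideal.Quotient.mk (srIdealW k W Δ) θ₁, Ideal.Quotient.mk (srIdealW k W Δ) θ₂] := by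
    refine isWeaklyRegular_pair (fun a ha => ?_) fun a b hab => ?_
    · obtain ⟨f, rfl⟩ := Ideal.Quotient.mk_surjective a
      rw [← map_mul, Ideal.Quotient.eq_zero_iff_mem, hmem] at ha
      rw [Ideal.Quotient.eq_zero_iff_mem, hmem]
      exact fun e he => restrictVars_eq_zero_of_sum_X_mul (hE e he) (ha e he)
    · obtain ⟨f, rfl⟩ := Ideal.Quotient.mk_surjective a
      obtain ⟨g, rfl⟩ := Ideal.Quotient.mk_surjective b
      rw [← map_mul, ← map_mul, Ideal.Quotient.eq, hmem] at hab
      obtain ⟨q, hq⟩ := exists_sum_X_mul_of_restrictVars hE hC hab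
      refine ⟨Ideal.Quotient.mk (srIdealW k W Δ) q, ?_⟩
      rw [← map_mul, Ideal.Quotient.eq, hmem]
      exact hq
  have hX : ∀ i : {x // x ∈ W}, (X i : MvPolynomial {x // x ∈ W} k) ∈
      Ideal.span (Set.range (X : {x // x ∈ W} → MvPolynomial {x // x ∈ W} k)) := fun i =>
    Ideal.subset_span ⟨i, rfl⟩
  have hirr : ∀ r ∈ [Ideal.Quotient.mk (srIdealW k W Δ) θ₁, Ideal.Quotient.mk (srIdealW k W Δ) θ₂],
      r ∈ srIrrelevantW k W Δ := by
    simp only [List.mem_cons, List.not_mem_nil, or_false]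
    rintro r (rfl | rfl)
    · exact Ideal.mem_map_of_mem _ (Ideal.sum_mem _ fun i _ => hX i)
    · refine Ideal.mem_map_of_mem _ (Ideal.sum_mem _ fun t ht => ?_)
      obtain ⟨i, hi⟩ : t.Nonempty := by
        rw [← Finset.card_pos, (Finset.mem_powersetCard.1 ht).2]
        exact two_pos
      rw [← Finset.mul_prod_erase _ _ hi]
      exact Ideal.mul_mem_right _ _ (hX i)
  refine ⟨_, hirr, isRegular_of_isWeaklyRegular (Δ.down_closed hF (Finset.empty_subset _))
    hirr hweak, ?_⟩
  rw [ringKrullDim_srRingW_eq_sup_card k hF (hW F hF) (hFcard ▸ hdim), hFcard]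
  rfl

end ConnectedGraph

section Lexsegment

lemma mem_faces_iff_of_srIdealW_eq_lexIdealW {k : Type*} [Field k] {n d : ℕ} {U V₀ : Finset ℕ}
    {Δ : SComplex ℕ}
    (hΔ : srIdealW k (Finset.Icc 1 n) Δ = lexIdealW k (Finset.Icc 1 n) n d U V₀)
    {F : Finset ℕ} (hF : F ⊆ Finset.Icc 1 n) :
    F ∈ Δ.faces ↔ ∀ S ∈ lexSegment n d U V₀, ¬ S ⊆ F := by
  let φ : MvPolynomial {x // x ∈ Finset.Icc 1 n} k →ₐ[k] k :=
    aeval fun i => if i.1 ∈ F then 1 else 0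
  have hφ0 : ∀ G ⊆ Finset.Icc 1 n, ¬ G ⊆ F → φ (monoW k (Finset.Icc 1 n) G) = 0 := by
    intro G hG hGF
    obtain ⟨i, hi, hiF⟩ := Finset.not_subset.1 hGF
    exact map_monoW_eq_zero (hG hi) hi φ.toRingHom (by simp [φ, hiF])
  have hφ1 : ∀ G ⊆ F, φ (monoW k (Finset.Icc 1 n) G) = 1 := by
    intro G hG
    rw [monoW, map_prod]
    refine Finset.prod_eq_one fun i hi => ?_
    simp [φ, hG (Finset.mem_subtype.1 hi)]
  have hnot : ∀ {I : Ideal (MvPolynomial {x // x ∈ Finset.Icc 1 n} k)} {G : Finset ℕ}, G ⊆ F →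
      monoW k (Finset.Icc 1 n) G ∈ I → ¬ I ≤ RingHom.ker φ := fun hG hI hle => by
    have h := hle hI
    rw [RingHom.mem_ker, hφ1 _ hG] at h
    exact one_ne_zero h
  constructor
  · intro hFΔ S hS hSF
    have hmem : monoW k (Finset.Icc 1 n) S ∈ srIdealW k (Finset.Icc 1 n) Δ :=
      hΔ ▸ Ideal.subset_span ⟨S, hS, rfl⟩
    refine hnot hSF hmem (Ideal.span_le.2 ?_)
    rintro _ ⟨G, hG, hGΔ, rfl⟩
    exact hφ0 G hG fun h => hGΔ (Δ.down_closed hFΔ h)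
  · intro h
    by_contra hFΔ
    have hmem : monoW k (Finset.Icc 1 n) F ∈ lexIdealW k (Finset.Icc 1 n) n d U V₀ :=
      hΔ ▸ Ideal.subset_span ⟨F, hF, hFΔ, rfl⟩
    refine hnot subset_rfl hmem (Ideal.span_le.2 ?_)
    rintro _ ⟨S, hS, rfl⟩
    exact hφ0 S hS.1 (h S hS)

end Lexsegment

section LexsegmentPairs

lemma Finset.exists_lt_of_card_eq_two {S : Finset ℕ} (hS : S.card = 2) :
    ∃ i j, i < j ∧ S = {i, j} := by
  obtain ⟨i, j, hij, rfl⟩ := Finset.card_eq_two.1 hS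
  rcases hij.lt_or_gt with h | h
  · exact ⟨i, j, h, rfl⟩
  · exact ⟨j, i, h, Finset.pair_comm i j⟩

lemma lexGT_pair_iff {a b i j : ℕ} (hab : a < b) (hij : i < j) :
    lexGT {a, b} {i, j} ↔ a < i ∨ a = i ∧ b < j := by
  simp only [lexGT, Finset.mem_insert, Finset.mem_singleton, not_or]
  constructor
  · rintro ⟨m, hm, ⟨hmi, hmj⟩, h⟩
    have hi := h i
    have hj := h j
    have ha := h a
    omega
  · rintro (h | ⟨rfl, h⟩)
    · exact ⟨a, by omega, by omega, fun x hx => by omega⟩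
    · exact ⟨b, by omega, by omega, fun x hx => by omega⟩

lemma lexGE_pair_iff {a b i j : ℕ} (hab : a < b) (hij : i < j) :
    lexGE {a, b} {i, j} ↔ a < i ∨ a = i ∧ b ≤ j := by
  rw [lexGE, lexGT_pair_iff hab hij]
  constructor
  · rintro (h | h)
    · simp only [Finset.ext_iff, Finset.mem_insert, Finset.mem_singleton] at h
      have := h a
      have := h b
      have := h i
      have := h j
      omega
    · omega
  · intro h
    by_cases hh : a = i ∧ b = j
    · exact Or.inl (by rw [hh.1, hh.2])
    · exact Or.inr (by omega)

lemma pair_mem_lexSegment_iff {n a b c d i j : ℕ} (hab : a < b) (hcd : c < d) (hij : i < j) :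
    {i, j} ∈ lexSegment n 2 {a, b} {c, d} ↔
      (1 ≤ i ∧ j ≤ n) ∧ (a < i ∨ a = i ∧ b ≤ j) ∧ (i < c ∨ i = c ∧ j ≤ d) := by
  have hsub : ({i, j} : Finset ℕ) ⊆ Finset.Icc 1 n ↔ 1 ≤ i ∧ j ≤ n := by
    simp only [Finset.insert_subset_iff, Finset.singleton_subset_iff, Finset.mem_Icc]
    omega
  simp only [lexSegment, Set.mem_ofPred_eq, hsub, Finset.card_pair hij.ne, true_and,
    lexGE_pair_iff hab hij, lexGE_pair_iff hij hcd]

end LexsegmentPairs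

end StanleyReisner

/-- A lexsegment complex in degree `2` (`u > v`) which is
Buchsbaum but not Cohen–Macaulay over `k` is disconnected. -/
theorem lexsegment_buchsbaum_not_CM_disconnected
    (k : Type*) [Field k] (n : ℕ)
    (U V₀ : Finset ℕ) (hUsub : U ⊆ Finset.Icc 1 n) (hVsub : V₀ ⊆ Finset.Icc 1 n)
    (hUcard : U.card = 2) (hVcard : V₀.card = 2) (huv : lexGT U V₀)
    (Δ : SComplex ℕ) (hΔsub : ∀ F ∈ Δ.faces, F ⊆ Finset.Icc 1 n)
    (hΔ : srIdealW k (Finset.Icc 1 n) Δ = lexIdealW k (Finset.Icc 1 n) n 2 U V₀)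
    (hB : IsCMtW k (Finset.Icc 1 n) 1 Δ) (hNCM : ¬ IsCMW k (Finset.Icc 1 n) Δ) :
    ¬ Δ.Connected := by
  intro hconn
  obtain ⟨a, b, hab, rfl⟩ := Finset.exists_lt_of_card_eq_two hUcard
  obtain ⟨c, d, hcd, rfl⟩ := Finset.exists_lt_of_card_eq_two hVcard
  rw [lexGT_pair_iff hab hcd] at huv
  simp only [Finset.insert_subset_iff, Finset.singleton_subset_iff, Finset.mem_Icc] at hUsub hVsub
  have hface := fun F (hF : F ⊆ Finset.Icc 1 n) => mem_faces_iff_of_srIdealW_eq_lexIdealW hΔ hF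
  have hvertex : ∀ x, 1 ≤ x → x ≤ n → {x} ∈ Δ.faces := by
    intro x hx hxn
    refine (hface _ (by simp [hx, hxn])).2 fun S hS hSx => ?_
    have := Finset.card_le_card hSx
    rw [hS.2.1, Finset.card_singleton] at this
    omega
  have hpair : ∀ i j, 1 ≤ i → i < j → j ≤ n →
      ({i, j} ∈ Δ.faces ↔ {i, j} ∉ lexSegment n 2 {a, b} {c, d}) := by
    intro i j hi hij hj
    rw [hface _ (by simp [Finset.insert_subset_iff]; omega)]
    refine ⟨fun h hS => h _ hS subset_rfl, fun h S hS hSij => h ?_⟩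
    rwa [← Finset.eq_of_subset_of_card_le hSij (by rw [hS.2.1, Finset.card_pair hij.ne])]
  -- A vertex dividing no generator would be a cone point.
  have hcone : ∀ p, 1 ≤ p → p ≤ n → ∃ S ∈ lexSegment n 2 {a, b} {c, d}, p ∈ S := by
    intro p hp hpn
    by_contra! hpS
    have hp' := hvertex p hp hpn
    refine hNCM (isCMW_of_cone hΔsub hp' (fun F hF => ?_) (hB.2 _ hp' (by simp)))
    have hFn := hΔsub F hF
    refine (hface _ (Finset.insert_subset (by simp [hp, hpn]) hFn)).2 fun S hS hSF => ?_
    exact (hface F hFn).1 hF S hS ((Finset.subset_insert_iff_of_notMem (hpS S hS)).1 hSF)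
  have hindex : ∀ p, 1 ≤ p → p ≤ n → ∃ q,
      (p < q ∧ (1 ≤ p ∧ q ≤ n) ∧ (a < p ∨ a = p ∧ b ≤ q) ∧ (p < c ∨ p = c ∧ q ≤ d)) ∨
      (q < p ∧ (1 ≤ q ∧ p ≤ n) ∧ (a < q ∨ a = q ∧ b ≤ p) ∧ (q < c ∨ q = c ∧ p ≤ d)) := by
    intro p hp hpn
    obtain ⟨S, hS, hpS⟩ := hcone p hp hpn
    obtain ⟨i, j, hij, rfl⟩ := Finset.exists_lt_of_card_eq_two hS.2.1
    rw [pair_mem_lexSegment_iff hab hcd hij] at hS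
    simp only [Finset.mem_insert, Finset.mem_singleton] at hpS
    rcases hpS with rfl | rfl
    · exact ⟨j, Or.inl ⟨hij, hS⟩⟩
    · exact ⟨i, Or.inr ⟨hij, hS⟩⟩
  obtain rfl : a = 1 := by
    obtain ⟨q, hq⟩ := hindex 1 le_rfl (by omega)
    omega
  obtain ⟨e, he, he'⟩ := hconn.exists_edge (hvertex 1 le_rfl (by omega))
    (hvertex 2 (by omega) (by omega)) (by omega)
  have hen := hΔsub _ he'
  simp only [Finset.insert_subset_iff, Finset.singleton_subset_iff, Finset.mem_Icc] at hen
  rw [hpair 1 e le_rfl (by omega) hen.2.2,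
    pair_mem_lexSegment_iff hab hcd (by omega)] at he'
  have hb : 3 ≤ b := by
    obtain ⟨q, hq⟩ := hindex n (by omega) le_rfl
    by_contra h
    omega
  have hc : 3 ≤ c ∨ c = 2 ∧ b ≤ d + 1 := by
    obtain ⟨q, hq⟩ := hindex 2 (by omega) (by omega)
    by_contra h
    obtain ⟨q', hq'⟩ := hindex (d + 1) (by omega) (by omega)
    omega
  have h12 : {1, 2} ∈ Δ.faces := by
    rw [hpair 1 2 le_rfl (by omega) (by omega), pair_mem_lexSegment_iff hab hcd (by omega)]
    omega
  have h12facet : Δ.IsFacet {1, 2} := by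
    refine ⟨h12, fun G hG hG' => hG'.antisymm fun j hj => ?_⟩
    by_contra hj'
    simp only [Finset.mem_insert, Finset.mem_singleton, not_or] at hj'
    have hjn := hΔsub G hG hj
    rw [Finset.mem_Icc] at hjn
    simp only [Finset.insert_subset_iff, Finset.singleton_subset_iff] at hG'
    have h1 : {1, j} ∈ Δ.faces := Δ.down_closed hG (by simp [Finset.insert_subset_iff, hG', hj])
    have h2 : {2, j} ∈ Δ.faces := Δ.down_closed hG (by simp [Finset.insert_subset_iff, hG', hj])
    rw [hpair _ _ (by omega) (by omega) hjn.2, pair_mem_lexSegment_iff hab hcd (by omega)] at h1 h2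
    omega
  obtain ⟨F, hF, hFmax⟩ := SComplex.exists_face_card_max hΔsub
    (Δ.down_closed h12 (Finset.empty_subset _))
  have hFfacet : Δ.IsFacet F :=
    ⟨hF, fun G hG hFG => Finset.eq_of_subset_of_card_le hFG (hFmax G hG)⟩
  have hFcard : F.card = 2 := hB.1 hFfacet h12facet
  exact hNCM (isCMW_of_connected_graph hΔsub (fun G hG => hFcard ▸ hFmax G hG) hconn hF hFcard)
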